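/- For every holomorphic function f on the open unit disc 𝔻 whose Taylor coefficients (f_n)_{n≥0} at 0 are real and belong to ℓ²_{3/4}, there exist unique holomorphic functions u and v on 𝔻, with real Taylor coefficients belonging to ℓ²_{3/4}, such that f(z) = u(z²)·√(1+z) + v(z²)·√(1−z) for all z ∈ 𝔻 (principal square roots). Moreover there exist absolute constants C₁, C₂ > 0 such that C₁(‖u‖ + ‖v‖) ≤ ‖f‖ ≤ C₂(‖u‖ + ‖v‖), where ‖·‖ denotes the ℓ²_{3/4}-norm of the Taylor coefficient sequence. -/

import Mathlib

open scoped BigOperators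

/-- Membership in the weighted space `ℓ²_r`: `Σ (1+n)^{2r} c_n² < ∞`. -/
def MemL2r (r : ℝ) (c : ℕ → ℝ) : Prop :=
  Summable (fun n : ℕ => (1 + (n : ℝ)) ^ (2 * r) * (c n) ^ 2)

/-- The `ℓ²_r`-norm. -/
noncomputable def normL2r (r : ℝ) (c : ℕ → ℝ) : ℝ :=
  (∑' n : ℕ, (1 + (n : ℝ)) ^ (2 * r) * (c n) ^ 2) ^ ((1 : ℝ) / 2)

/-- `(u, v)` (given by their real Taylor coefficient sequences, in `ℓ²_{3/4}`) represent the
function with coefficients `a` via `f(z) = u(z²)√(1+z) + v(z²)√(1-z)` on the unit disc. -/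
def Rep12 (a u v : ℕ → ℝ) : Prop :=
  MemL2r (3 / 4) u ∧ MemL2r (3 / 4) v ∧
  ∀ z ∈ Metric.ball (0 : ℂ) 1,
    (∑' n : ℕ, (a n : ℂ) * z ^ n)
      = (∑' n : ℕ, (u n : ℂ) * z ^ (2 * n)) * (1 + z) ^ ((1 : ℂ) / 2)
        + (∑' n : ℕ, (v n : ℂ) * z ^ (2 * n)) * (1 - z) ^ ((1 : ℂ) / 2)

open Finset.HasAntidiagonal (antidiagonal)

/-- The square of the `ℓ²_r`-norm. -/
noncomputable def sqNorm (r : ℝ) (c : ℕ → ℝ) : ℝ :=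
  ∑' n : ℕ, (1 + (n : ℝ)) ^ (2 * r) * (c n) ^ 2

theorem normL2r_eq_sqrt (r : ℝ) (c : ℕ → ℝ) : normL2r r c = √(sqNorm r c) :=
  (Real.sqrt_eq_rpow _).symm

theorem sqNorm_nonneg (r : ℝ) (c : ℕ → ℝ) : 0 ≤ sqNorm r c :=
  tsum_nonneg fun _ => by positivity

theorem one_add_rpow_two_mul (r : ℝ) (n : ℕ) :
    (1 + (n : ℝ)) ^ (2 * r) = ((1 + (n : ℝ)) ^ r) ^ 2 := by
  rw [mul_comm, Real.rpow_mul (by positivity)]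
  norm_cast

theorem memL2r_iff (r : ℝ) (c : ℕ → ℝ) :
    MemL2r r c ↔ Summable fun n : ℕ => ((1 + (n : ℝ)) ^ r * |c n|) ^ 2 := by
  simp only [MemL2r, one_add_rpow_two_mul, mul_pow, sq_abs]

theorem sqNorm_eq (r : ℝ) (c : ℕ → ℝ) :
    sqNorm r c = ∑' n : ℕ, ((1 + (n : ℝ)) ^ r * |c n|) ^ 2 := by
  simp only [sqNorm, one_add_rpow_two_mul, mul_pow, sq_abs]

/-- If the weighted squares are dominated by a summable `g`, the sequence lies in `ℓ²_r`. -/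
theorem memL2r_and_sqNorm_le {r K : ℝ} {c : ℕ → ℝ} {g : ℕ → ℝ} (hg : Summable g)
    (h : ∀ n : ℕ, (1 + (n : ℝ)) ^ (2 * r) * (c n) ^ 2 ≤ g n) (hK : ∑' n, g n ≤ K) :
    MemL2r r c ∧ sqNorm r c ≤ K := by
  have hs : MemL2r r c := Summable.of_nonneg_of_le (fun n => by positivity) h hg
  exact ⟨hs, (Summable.tsum_le_tsum h hs hg).trans hK⟩

/-- Young's inequality `ℓ² * ℓ¹ ⊆ ℓ²` for a nonnegative `ℓ¹` factor. -/
theorem summable_sq_antidiagonal_and_tsum_le {A b : ℕ → ℝ} (hb : ∀ n, 0 ≤ b n)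
    (sA : Summable fun n => A n ^ 2) (sb : Summable b) :
    Summable (fun n => (∑ p ∈ antidiagonal n, A p.1 * b p.2) ^ 2) ∧
      ∑' n, (∑ p ∈ antidiagonal n, A p.1 * b p.2) ^ 2
        ≤ (∑' n, A n ^ 2) * (∑' n, b n) ^ 2 := by
  have sA' : Summable fun n => ‖A n ^ 2‖ := sA.norm
  have sb' : Summable fun n => ‖b n‖ := sb.norm
  have hsum : Summable fun n => (∑ p ∈ antidiagonal n, A p.1 ^ 2 * b p.2) * ∑' n, b n :=
    (summable_norm_sum_mul_antidiagonal_of_summable_norm sA' sb').of_norm.mul_right _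
  have hle : ∀ n, (∑ p ∈ antidiagonal n, A p.1 * b p.2) ^ 2
      ≤ (∑ p ∈ antidiagonal n, A p.1 ^ 2 * b p.2) * ∑' n, b n := by
    intro n
    have h1 : (∑ p ∈ antidiagonal n, A p.1 * b p.2) ^ 2
        ≤ (∑ p ∈ antidiagonal n, A p.1 ^ 2 * b p.2)
          * ∑ p ∈ antidiagonal n, b p.2 :=
      Finset.sum_sq_le_sum_mul_sum_of_sq_le_mul _
        (fun p _ => mul_nonneg (sq_nonneg _) (hb _)) (fun p _ => hb _) (fun p _ => by rw [mul_pow]; linarith)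
    refine h1.trans (mul_le_mul_of_nonneg_left ?_
      (Finset.sum_nonneg fun p _ => mul_nonneg (sq_nonneg _) (hb _)))
    rw [← Finset.Nat.sum_antidiagonal_swap, Finset.Nat.sum_antidiagonal_eq_sum_range_succ_mk]
    exact sb.sum_le_tsum _ fun i _ => hb i
  have hS := Summable.of_nonneg_of_le (fun n => sq_nonneg _) hle hsum
  refine ⟨hS, (Summable.tsum_le_tsum hle hS hsum).trans_eq ?_⟩
  rw [tsum_mul_right, ← tsum_mul_tsum_eq_tsum_sum_antidiagonal_of_summable_norm sA' sb']
  ring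

theorem summable_one_add_rpow_neg {s : ℝ} (hs : 1 < s) :
    Summable fun n : ℕ => ((1 + (n : ℝ)) ^ s)⁻¹ := by
  have := (Real.summable_one_div_nat_add_rpow 1 s).2 hs
  refine this.congr fun n => ?_
  rw [abs_of_nonneg (by positivity), add_comm, one_div]

/-- `ℓ²_r ⊆ ℓ¹` for `r > 1/2`. -/
theorem MemL2r.summable_abs {r : ℝ} (hr : 1 / 2 < r) {c : ℕ → ℝ} (hc : MemL2r r c) :
    Summable (fun n => |c n|) ∧
      (∑' n, |c n|) ^ 2 ≤ (∑' n : ℕ, ((1 + (n : ℝ)) ^ (2 * r))⁻¹) * sqNorm r c := by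
  have hz := summable_one_add_rpow_neg (s := 2 * r) (by linarith)
  have hs : Summable fun n => |c n| := by
    refine Summable.of_nonneg_of_le (fun n => abs_nonneg _) (fun n => ?_) (hc.add hz)
    have hw : 0 < (1 + (n : ℝ)) ^ r := by positivity
    rw [one_add_rpow_two_mul, ← sq_abs (c n), ← mul_pow, ← inv_pow]
    have : |c n| = ((1 + (n : ℝ)) ^ r * |c n|) * ((1 + (n : ℝ)) ^ r)⁻¹ := by
      field_simp
    nlinarith [sq_nonneg ((1 + (n : ℝ)) ^ r * |c n| - ((1 + (n : ℝ)) ^ r)⁻¹),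
      sq_nonneg ((1 + (n : ℝ)) ^ r * |c n|), sq_nonneg ((1 + (n : ℝ)) ^ r)⁻¹]
  refine ⟨hs, ?_⟩
  refine le_of_tendsto (hs.hasSum.tendsto_sum_nat.pow 2) (Filter.Eventually.of_forall fun N => ?_)
  refine (Finset.sum_sq_le_sum_mul_sum_of_sq_le_mul (Finset.range N)
    (f := fun n : ℕ => ((1 + (n : ℝ)) ^ (2 * r))⁻¹)
    (g := fun n : ℕ => (1 + (n : ℝ)) ^ (2 * r) * (c n) ^ 2)
    (fun n _ => by positivity) (fun n _ => by positivity) (fun n _ => ?_)).trans ?_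
  · have : 0 < (1 + (n : ℝ)) ^ (2 * r) := by positivity
    rw [sq_abs, inv_mul_cancel_left₀ this.ne']
  · exact mul_le_mul (hz.sum_le_tsum _ fun i _ => by positivity)
      (hc.sum_le_tsum _ fun i _ => by positivity) (Finset.sum_nonneg fun i _ => by positivity)
      (tsum_nonneg fun i => by positivity)

/-- The Cauchy product of two sequences. -/
def cauchyProd (a b : ℕ → ℝ) (n : ℕ) : ℝ :=
  ∑ p ∈ antidiagonal n, a p.1 * b p.2

theorem one_add_rpow_le_add {r : ℝ} (h0 : 0 ≤ r) (h1 : r ≤ 1) (i j : ℕ) :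
    (1 + ((i + j : ℕ) : ℝ)) ^ r ≤ (1 + (i : ℝ)) ^ r + (1 + (j : ℝ)) ^ r := by
  refine le_trans ?_ (Real.rpow_add_le_add_rpow (by positivity) (by positivity) h0 h1)
  refine Real.rpow_le_rpow (by positivity) ?_ h0
  push_cast
  linarith

/-- `ℓ²_r` is closed under Cauchy products for `1/2 < r ≤ 1`. -/
theorem MemL2r.cauchyProd {r : ℝ} (hr : 1 / 2 < r) (hr1 : r ≤ 1) {a b : ℕ → ℝ}
    (ha : MemL2r r a) (hb : MemL2r r b) :
    MemL2r r (cauchyProd a b) ∧ sqNorm r (cauchyProd a b)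
      ≤ 4 * (∑' n : ℕ, ((1 + (n : ℝ)) ^ (2 * r))⁻¹) * sqNorm r b * sqNorm r a := by
  obtain ⟨sa, la⟩ := ha.summable_abs hr
  obtain ⟨sb, lb⟩ := hb.summable_abs hr
  obtain ⟨s1, l1⟩ := summable_sq_antidiagonal_and_tsum_le
    (A := fun n : ℕ => (1 + (n : ℝ)) ^ r * |a n|)
    (fun n => abs_nonneg (b n)) ((memL2r_iff r a).1 ha) sb
  obtain ⟨s2, l2⟩ := summable_sq_antidiagonal_and_tsum_le
    (A := fun n : ℕ => (1 + (n : ℝ)) ^ r * |b n|)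
    (fun n => abs_nonneg (a n)) ((memL2r_iff r b).1 hb) sa
  rw [← sqNorm_eq] at l1 l2
  refine memL2r_and_sqNorm_le ((s1.add s2).mul_left 2) (fun n => ?_) ?_
  · rw [one_add_rpow_two_mul, ← sq_abs (_root_.cauchyProd a b n), ← mul_pow]
    have hw : 0 < (1 + (n : ℝ)) ^ r := by positivity
    have key : (1 + (n : ℝ)) ^ r * |_root_.cauchyProd a b n|
        ≤ (∑ p ∈ antidiagonal n, (1 + (p.1 : ℝ)) ^ r * |a p.1| * |b p.2|)
          + ∑ p ∈ antidiagonal n, (1 + (p.1 : ℝ)) ^ r * |b p.1| * |a p.2| := by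
      rw [← Finset.Nat.sum_antidiagonal_swap (n := n)
        (f := fun p : ℕ × ℕ => (1 + (p.1 : ℝ)) ^ r * |b p.1| * |a p.2|),
        ← Finset.sum_add_distrib]
      refine (mul_le_mul_of_nonneg_left (Finset.abs_sum_le_sum_abs _ _) hw.le).trans ?_
      rw [Finset.mul_sum]
      refine Finset.sum_le_sum fun p hp => ?_
      have hp' := Finset.HasAntidiagonal.mem_antidiagonal.1 hp
      have h := one_add_rpow_le_add (by linarith) hr1 p.1 p.2
      rw [hp'] at h
      rw [abs_mul]
      refine (mul_le_mul_of_nonneg_right h (by positivity)).trans_eq ?_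
      simp only [Prod.fst_swap, Prod.snd_swap]
      ring
    refine (pow_le_pow_left₀ (by positivity) key 2).trans ?_
    exact add_sq_le
  · rw [tsum_mul_left, s1.tsum_add s2]
    nlinarith [mul_le_mul_of_nonneg_left lb (sqNorm_nonneg r a),
      mul_le_mul_of_nonneg_left la (sqNorm_nonneg r b)]

/-- The Taylor coefficients of `√(1 + z)`. -/
noncomputable def sqrtCoeff (n : ℕ) : ℝ := Ring.choose (1 / 2 : ℝ) n

/-- The Taylor coefficients of `√(1 - z)`. -/
noncomputable def sqrtCoeffNeg (n : ℕ) : ℝ := (-1) ^ n * sqrtCoeff n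

theorem sqrtCoeff_succ (n : ℕ) : sqrtCoeff (n + 1) = sqrtCoeff n * ((1 / 2 - n) / (n + 1)) := by
  have hn : ((n : ℝ) + 1) ≠ 0 := by positivity
  have h := Ring.choose_smul_choose (1 / 2 : ℝ) (n := n + 1) (k := n) n.le_succ
  simp only [Nat.choose_succ_self_right, Nat.add_sub_cancel_left, Ring.choose_one_right,
    nsmul_eq_mul] at h
  push_cast at h
  rw [sqrtCoeff, sqrtCoeff, mul_div_assoc', eq_div_iff hn, ← h]
  ring

theorem sqrtCoeff_sq_mul_le (n : ℕ) : sqrtCoeff n ^ 2 * (1 + (n : ℝ)) ^ 3 ≤ 2 := by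
  have h0 : sqrtCoeff 0 = 1 := by simp [sqrtCoeff]
  rcases n with _ | n
  · norm_num [h0]
  induction n with
  | zero => norm_num [sqrtCoeff_succ, h0]
  | succ n ih =>
    refine le_trans ?_ ih
    rw [sqrtCoeff_succ (n + 1), mul_pow, mul_assoc]
    refine mul_le_mul_of_nonneg_left ?_ (sq_nonneg _)
    push_cast
    rw [div_pow, div_mul_eq_mul_div, div_le_iff₀ (by positivity)]
    have : (0 : ℝ) ≤ n := n.cast_nonneg
    nlinarith [pow_nonneg this 2, pow_nonneg this 3, pow_nonneg this 4, pow_nonneg this 5]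

theorem memL2r_sqrtCoeff : MemL2r (3 / 4) sqrtCoeff := by
  have hz := (summable_one_add_rpow_neg (s := 3 / 2) (by norm_num)).mul_left 2
  refine (memL2r_and_sqNorm_le hz (fun n => ?_) le_rfl).1
  have hw : 0 < (1 + (n : ℝ)) ^ (3 / 2 : ℝ) := by positivity
  have h3 : (1 + (n : ℝ)) ^ 3 = (1 + (n : ℝ)) ^ (3 / 2 : ℝ) * (1 + (n : ℝ)) ^ (3 / 2 : ℝ) := by
    rw [← Real.rpow_add (by positivity), ← Real.rpow_natCast]
    norm_num
  have h := sqrtCoeff_sq_mul_le n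
  rw [h3] at h
  rw [show (2 * (3 / 4) : ℝ) = 3 / 2 by norm_num, ← div_eq_mul_inv, le_div_iff₀ hw]
  linarith

theorem sqrtCoeffNeg_sq (n : ℕ) : sqrtCoeffNeg n ^ 2 = sqrtCoeff n ^ 2 := by
  rw [sqrtCoeffNeg, mul_pow, ← pow_mul, mul_comm n, pow_mul]
  simp

theorem memL2r_sqrtCoeffNeg : MemL2r (3 / 4) sqrtCoeffNeg := by
  simpa only [MemL2r, sqrtCoeffNeg_sq] using memL2r_sqrtCoeff

theorem sqNorm_sqrtCoeffNeg (r : ℝ) : sqNorm r sqrtCoeffNeg = sqNorm r sqrtCoeff := by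
  simp only [sqNorm, sqrtCoeffNeg_sq]

theorem hasSum_sqrtCoeff {z : ℂ} (hz : z ∈ Metric.ball (0 : ℂ) 1) :
    HasSum (fun n => (sqrtCoeff n : ℂ) * z ^ n) ((1 + z) ^ ((1 : ℂ) / 2)) := by
  have h := (Complex.one_add_cpow_hasFPowerSeriesOnBall_zero (a := 1 / 2)).hasSum (y := z)
    (by simpa [Metric.mem_eball, edist_zero_right, ← ofReal_norm] using hz)
  simp only [zero_add] at h
  have e : (fun n => (sqrtCoeff n : ℂ) * z ^ n) =
      fun n => binomialSeries ℂ (1 / 2 : ℂ) n fun _ => z := by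
    ext n
    rw [sqrtCoeff, Complex.ofReal_choose, binomialSeries_apply]
    simp
  rwa [e]

theorem hasSum_sqrtCoeffNeg {z : ℂ} (hz : z ∈ Metric.ball (0 : ℂ) 1) :
    HasSum (fun n => (sqrtCoeffNeg n : ℂ) * z ^ n) ((1 - z) ^ ((1 : ℂ) / 2)) := by
  have h := hasSum_sqrtCoeff (z := -z) (by simpa using hz)
  rw [← sub_eq_add_neg] at h
  convert h using 2 with n
  rw [neg_pow, sqrtCoeffNeg]
  push_cast
  ring

/-- The coefficients of `u(z²)`. -/
def evenExt (u : ℕ → ℝ) (n : ℕ) : ℝ := if Even n then u (n / 2) else 0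

theorem evenExt_two_mul (u : ℕ → ℝ) (n : ℕ) : evenExt u (2 * n) = u n := by
  simp [evenExt]

theorem evenExt_two_mul_add_one (u : ℕ → ℝ) (n : ℕ) : evenExt u (2 * n + 1) = 0 := by
  simp [evenExt]

theorem two_mul_injective : Function.Injective fun n : ℕ => 2 * n := fun _ _ h => by
  simpa using h

theorem eq_zero_of_notMem_range_two_mul {α : Type*} [Zero α] {g : ℕ → α}
    (h : ∀ n, g (2 * n + 1) = 0) (x : ℕ) (hx : x ∉ Set.range fun n : ℕ => 2 * n) : g x = 0 := by
  rcases Nat.even_or_odd' x with ⟨k, rfl | rfl⟩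
  · exact absurd ⟨k, rfl⟩ hx
  · exact h k

theorem memL2r_evenExt {u : ℕ → ℝ} (hu : MemL2r (3 / 4) u) :
    MemL2r (3 / 4) (evenExt u) ∧ sqNorm (3 / 4) (evenExt u) ≤ 4 * sqNorm (3 / 4) u := by
  set g : ℕ → ℝ := fun n => 4 * ((1 + ((n / 2 : ℕ) : ℝ)) ^ (2 * (3 / 4 : ℝ)) * evenExt u n ^ 2)
  have hg : ∀ n, g (2 * n + 1) = 0 := fun n => by simp [g, evenExt_two_mul_add_one]
  have hg' : (g ∘ fun n : ℕ => 2 * n)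
      = fun n : ℕ => 4 * ((1 + (n : ℝ)) ^ (2 * (3 / 4 : ℝ)) * u n ^ 2) := by
    ext n
    simp [g, evenExt_two_mul]
  have hs : Summable g := by
    rw [← two_mul_injective.summable_iff (eq_zero_of_notMem_range_two_mul hg), hg']
    exact hu.mul_left 4
  refine memL2r_and_sqNorm_le hs (fun n => ?_) ?_
  · rcases Nat.even_or_odd' n with ⟨k, rfl | rfl⟩
    · simp only [g]
      rw [← mul_assoc]
      refine mul_le_mul_of_nonneg_right ?_ (sq_nonneg _)
      have h4 : (2 : ℝ) ^ (2 * (3 / 4) : ℝ) ≤ 4 := by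
        calc (2 : ℝ) ^ (2 * (3 / 4) : ℝ) ≤ 2 ^ (2 : ℝ) :=
              Real.rpow_le_rpow_of_exponent_le (by norm_num) (by norm_num)
          _ = 4 := by norm_num
      calc (1 + ((2 * k : ℕ) : ℝ)) ^ (2 * (3 / 4) : ℝ)
          ≤ (2 * (1 + (k : ℝ))) ^ (2 * (3 / 4) : ℝ) :=
            Real.rpow_le_rpow (by positivity) (by push_cast; linarith) (by norm_num)
        _ = 2 ^ (2 * (3 / 4) : ℝ) * (1 + (k : ℝ)) ^ (2 * (3 / 4) : ℝ) :=
            Real.mul_rpow (by norm_num) (by positivity)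
        _ ≤ 4 * (1 + ((2 * k / 2 : ℕ) : ℝ)) ^ (2 * (3 / 4) : ℝ) := by
            rw [Nat.mul_div_cancel_left k two_pos]
            exact mul_le_mul_of_nonneg_right h4 (by positivity)
    · rw [hg, evenExt_two_mul_add_one]
      simp
  · rw [← two_mul_injective.tsum_eq (f := g)
      (fun x hx => by_contra fun h => hx (eq_zero_of_notMem_range_two_mul hg x h))]
    refine le_of_eq ((tsum_congr fun n => congrFun hg' n).trans ?_)
    rw [tsum_mul_left, sqNorm]

theorem memL2r_oddPart {c d : ℕ → ℝ} {r : ℝ} (hr : 0 ≤ r) (hc : MemL2r r c)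
    (hd : ∀ n, d n ^ 2 = c (2 * n + 1) ^ 2) :
    MemL2r r d ∧ sqNorm r d ≤ sqNorm r c := by
  have hinj : Function.Injective fun n : ℕ => 2 * n + 1 := fun _ _ h => by simpa using h
  refine memL2r_and_sqNorm_le (hc.comp_injective hinj) (fun n => ?_)
    (_root_.tsum_comp_le_tsum_of_inj hc (fun _ => by positivity) hinj)
  rw [hd]
  refine mul_le_mul_of_nonneg_right ?_ (sq_nonneg _)
  refine Real.rpow_le_rpow (by positivity) ?_ (by positivity)
  push_cast
  have : (0 : ℝ) ≤ n := n.cast_nonneg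
  linarith

theorem tsum_evenExt (u : ℕ → ℝ) (z : ℂ) :
    ∑' n, (evenExt u n : ℂ) * z ^ n = ∑' n, (u n : ℂ) * z ^ (2 * n) := by
  rw [← two_mul_injective.tsum_eq (f := fun n => (evenExt u n : ℂ) * z ^ n)
    (fun x hx => by_contra fun h => hx (eq_zero_of_notMem_range_two_mul
      (g := fun n => (evenExt u n : ℂ) * z ^ n)
      (fun n => by simp [evenExt_two_mul_add_one]) x h))]
  simp only [evenExt_two_mul]

theorem summable_norm_mul_pow {c : ℕ → ℝ} (hc : Summable fun n => |c n|) {z : ℂ}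
    (hz : z ∈ Metric.ball (0 : ℂ) 1) : Summable fun n => ‖(c n : ℂ) * z ^ n‖ := by
  refine Summable.of_nonneg_of_le (fun n => norm_nonneg _) (fun n => ?_) hc
  rw [norm_mul, norm_pow, Complex.norm_real, Real.norm_eq_abs]
  have : ‖z‖ ≤ 1 := (mem_ball_zero_iff.1 hz).le
  exact mul_le_of_le_one_right (abs_nonneg _) (pow_le_one₀ (norm_nonneg _) this)

theorem tsum_cauchyProd {a b : ℕ → ℝ} (ha : Summable fun n => |a n|)
    (hb : Summable fun n => |b n|) {z : ℂ} (hz : z ∈ Metric.ball (0 : ℂ) 1) :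
    ∑' n, (cauchyProd a b n : ℂ) * z ^ n
      = (∑' n, (a n : ℂ) * z ^ n) * ∑' n, (b n : ℂ) * z ^ n := by
  rw [tsum_mul_tsum_eq_tsum_sum_antidiagonal_of_summable_norm (summable_norm_mul_pow ha hz)
    (summable_norm_mul_pow hb hz)]
  refine tsum_congr fun n => ?_
  rw [cauchyProd, Complex.ofReal_sum, Finset.sum_mul]
  refine Finset.sum_congr rfl fun p hp => ?_
  rw [← Finset.HasAntidiagonal.mem_antidiagonal.1 hp, pow_add]
  push_cast
  ring

/-- Absolutely summable coefficients are determined by the sum of the power series. -/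
theorem eq_of_tsum_mul_pow_eq {a b : ℕ → ℝ} (ha : Summable fun n => |a n|)
    (hb : Summable fun n => |b n|)
    (h : ∀ z ∈ Metric.ball (0 : ℂ) 1,
      ∑' n, (a n : ℂ) * z ^ n = ∑' n, (b n : ℂ) * z ^ n) : a = b := by
  have key : ∀ c : ℕ → ℝ, (Summable fun n => |c n|) →
      HasFPowerSeriesAt (fun z : ℂ => ∑' n, (c n : ℂ) * z ^ n)
        (.ofScalars ℂ fun n => (c n : ℂ)) 0 := by
    intro c hc
    rw [hasFPowerSeriesAt_iff]
    filter_upwards [Metric.ball_mem_nhds (0 : ℂ) one_pos] with z hz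
    simpa [FormalMultilinearSeries.coeff_ofScalars, mul_comm] using
      (summable_norm_mul_pow hc hz).of_norm.hasSum
  have he := (key a ha).eq_formalMultilinearSeries_of_eventually (key b hb)
    (Filter.eventually_of_mem (Metric.ball_mem_nhds (0 : ℂ) one_pos) h)
  rw [FormalMultilinearSeries.ofScalars_series_eq_iff] at he
  ext n
  exact_mod_cast congrFun he n

theorem rep12_iff {a u v : ℕ → ℝ} (ha : MemL2r (3 / 4) a) :
    Rep12 a u v ↔ MemL2r (3 / 4) u ∧ MemL2r (3 / 4) v ∧
      a = cauchyProd (evenExt u) sqrtCoeff + cauchyProd (evenExt v) sqrtCoeffNeg := by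
  refine and_congr_right fun hu => and_congr_right fun hv => ?_
  have hr : (1 / 2 : ℝ) < 3 / 4 := by norm_num
  have hr1 : (3 / 4 : ℝ) ≤ 1 := by norm_num
  have hU := (memL2r_evenExt hu).1
  have hV := (memL2r_evenExt hv).1
  have sU := (hU.summable_abs hr).1
  have sV := (hV.summable_abs hr).1
  have sS := (memL2r_sqrtCoeff.summable_abs hr).1
  have sS' := (memL2r_sqrtCoeffNeg.summable_abs hr).1
  have s1 := ((hU.cauchyProd hr hr1 memL2r_sqrtCoeff).1.summable_abs hr).1
  have s2 := ((hV.cauchyProd hr hr1 memL2r_sqrtCoeffNeg).1.summable_abs hr).1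
  have hsum : ∀ z ∈ Metric.ball (0 : ℂ) 1,
      ∑' n, ((cauchyProd (evenExt u) sqrtCoeff + cauchyProd (evenExt v) sqrtCoeffNeg) n : ℝ)
        * z ^ n = (∑' n : ℕ, (u n : ℂ) * z ^ (2 * n)) * (1 + z) ^ ((1 : ℂ) / 2)
        + (∑' n : ℕ, (v n : ℂ) * z ^ (2 * n)) * (1 - z) ^ ((1 : ℂ) / 2) := by
    intro z hz
    rw [← tsum_evenExt u, ← tsum_evenExt v, ← (hasSum_sqrtCoeff hz).tsum_eq,
      ← (hasSum_sqrtCoeffNeg hz).tsum_eq, ← tsum_cauchyProd sU sS hz,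
      ← tsum_cauchyProd sV sS' hz, ← (summable_norm_mul_pow s1 hz).of_norm.tsum_add
        (summable_norm_mul_pow s2 hz).of_norm]
    refine tsum_congr fun n => ?_
    simp only [Pi.add_apply, Complex.ofReal_add]
    ring
  constructor
  · intro h
    refine eq_of_tsum_mul_pow_eq (ha.summable_abs hr).1 ?_ fun z hz => ?_
    · exact Summable.of_nonneg_of_le (fun n => abs_nonneg _) (fun n => abs_add_le _ _) (s1.add s2)
    · rw [h z hz, hsum z hz]
  · intro h z hz
    rw [← hsum z hz, ← h]

section FormalPowerSeries

open PowerSeries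

theorem mk_cauchyProd (a b : ℕ → ℝ) : mk (cauchyProd a b) = mk a * mk b := by
  ext n
  simp [cauchyProd, coeff_mul]

theorem mk_sqrtCoeff_sq : mk sqrtCoeff ^ 2 = 1 + X := by
  have h : mk sqrtCoeff = PowerSeries.binomialSeries ℝ (1 / 2 : ℝ) := by
    ext n
    simp [sqrtCoeff]
  rw [h, sq, ← binomialSeries_add, show (1 / 2 + 1 / 2 : ℝ) = ((1 : ℕ) : ℝ) by norm_num,
    binomialSeries_nat, pow_one]

theorem rescale_mk_sqrtCoeff : rescale (-1) (mk sqrtCoeff) = mk sqrtCoeffNeg := by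
  ext n
  simp [coeff_rescale, sqrtCoeffNeg]

theorem rescale_mk_sqrtCoeffNeg : rescale (-1) (mk sqrtCoeffNeg) = mk sqrtCoeff := by
  ext n
  simp [coeff_rescale, sqrtCoeffNeg, ← mul_assoc, ← mul_pow]

theorem mk_sqrtCoeffNeg_sq : mk sqrtCoeffNeg ^ 2 = 1 - X := by
  rw [← rescale_mk_sqrtCoeff, ← map_pow, mk_sqrtCoeff_sq, map_add, rescale_X]
  simp [sub_eq_add_neg]

theorem rescale_mk_evenExt (u : ℕ → ℝ) : rescale (-1) (mk (evenExt u)) = mk (evenExt u) := by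
  ext n
  rcases Nat.even_or_odd' n with ⟨k, rfl | rfl⟩
  · simp [coeff_rescale, pow_mul]
  · simp [coeff_rescale, evenExt_two_mul_add_one]

/-- Twice the odd part of a power series. -/
theorem sub_rescale_eq_two_X_mul (F : PowerSeries ℝ) :
    F - rescale (-1) F = 2 * X * mk (evenExt fun n => coeff (2 * n + 1) F) := by
  have h2 : (2 : PowerSeries ℝ) = C (2 : ℝ) := (map_ofNat C 2).symm
  rw [mul_assoc, h2]
  ext n
  rcases Nat.even_or_odd' n with ⟨k, rfl | rfl⟩
  · rcases k with _ | k
    · rw [mul_zero, map_sub, coeff_rescale, coeff_C_mul, coeff_zero_X_mul]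
      simp
    · rw [show 2 * (k + 1) = (2 * k + 1) + 1 by ring, coeff_C_mul, coeff_succ_X_mul, coeff_mk,
        evenExt_two_mul_add_one, map_sub, coeff_rescale, show 2 * k + 1 + 1 = 2 * (k + 1) by ring,
        pow_mul]
      simp
  · rw [coeff_C_mul, coeff_succ_X_mul, coeff_mk, evenExt_two_mul, map_sub, coeff_rescale,
      pow_succ, pow_mul]
    simp
    ring

theorem evenExt_injective : Function.Injective evenExt := fun u v h => by
  ext n
  rw [← evenExt_two_mul u, h, evenExt_two_mul]

theorem two_mul_X_ne_zero : (2 * X : PowerSeries ℝ) ≠ 0 := fun h => by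
  have h1 := congrArg (coeff 1) h
  rw [show (2 : PowerSeries ℝ) = C (2 : ℝ) from (map_ofNat C 2).symm, coeff_C_mul] at h1
  simp at h1

theorem mk_evenExt_injective {u v : ℕ → ℝ}
    (h : (2 * X * mk (evenExt u) : PowerSeries ℝ) = 2 * X * mk (evenExt v)) : u = v := by
  have h' := mul_left_cancel₀ two_mul_X_ne_zero h
  refine evenExt_injective (funext fun n => ?_)
  simpa using congrArg (coeff n) h'

/-- Inversion of `(u, v) ↦ u(z²)√(1+z) + v(z²)√(1-z)` at the level of coefficients. -/
theorem eq_cauchyProd_add_iff (a u v : ℕ → ℝ) :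
    a = cauchyProd (evenExt u) sqrtCoeff + cauchyProd (evenExt v) sqrtCoeffNeg ↔
      u = (fun n => cauchyProd a sqrtCoeff (2 * n + 1)) ∧
      v = fun n => -cauchyProd a sqrtCoeffNeg (2 * n + 1) := by
  have hS := mk_sqrtCoeff_sq
  have hS' := mk_sqrtCoeffNeg_sq
  have hu := sub_rescale_eq_two_X_mul (mk a * mk sqrtCoeff)
  have hv := sub_rescale_eq_two_X_mul (-(mk a * mk sqrtCoeffNeg))
  simp only [← mk_cauchyProd, coeff_mk, map_neg] at hu hv
  simp only [mk_cauchyProd, map_mul, rescale_mk_sqrtCoeff, rescale_mk_sqrtCoeffNeg] at hu hv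
  constructor
  · intro h
    have hA : mk a = mk (evenExt u) * mk sqrtCoeff + mk (evenExt v) * mk sqrtCoeffNeg := by
      rw [← mk_cauchyProd, ← mk_cauchyProd]
      ext n
      simp [congrFun h n]
    have hRA : rescale (-1) (mk a)
        = mk (evenExt u) * mk sqrtCoeffNeg + mk (evenExt v) * mk sqrtCoeff := by
      rw [hA]
      simp only [map_add, map_mul, rescale_mk_sqrtCoeff, rescale_mk_sqrtCoeffNeg,
        rescale_mk_evenExt]
    constructor
    · apply mk_evenExt_injective
      rw [← hu, hRA, hA]
      linear_combination mk (evenExt u) * (hS' - hS)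
    · apply mk_evenExt_injective
      rw [← hv, hRA, hA]
      linear_combination mk (evenExt v) * (hS' - hS)
  · rintro ⟨rfl, rfl⟩
    have h : mk a = mk (cauchyProd (evenExt fun n => cauchyProd a sqrtCoeff (2 * n + 1)) sqrtCoeff
        + cauchyProd (evenExt fun n => -cauchyProd a sqrtCoeffNeg (2 * n + 1)) sqrtCoeffNeg) := by
      refine mul_left_cancel₀ two_mul_X_ne_zero ?_
      refine Eq.trans ?_ (congrArg (2 * X * ·) (?_ : _ =
        mk (cauchyProd (evenExt fun n => cauchyProd a sqrtCoeff (2 * n + 1)) sqrtCoeff)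
        + mk (cauchyProd (evenExt fun n => -cauchyProd a sqrtCoeffNeg (2 * n + 1)) sqrtCoeffNeg))).symm
      · simp only [mk_cauchyProd]
        linear_combination mk sqrtCoeff * hu + mk sqrtCoeffNeg * hv + mk a * (hS' - hS)
      · ext n
        simp
    ext n
    simpa using congrArg (coeff n) h

end FormalPowerSeries

theorem sqNorm_add_le {r : ℝ} {a b : ℕ → ℝ} (ha : MemL2r r a) (hb : MemL2r r b) :
    sqNorm r (a + b) ≤ 2 * (sqNorm r a + sqNorm r b) := by
  refine (memL2r_and_sqNorm_le ((Summable.add ha hb).mul_left 2) (fun n => ?_) ?_).2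
  · rw [← mul_add, mul_left_comm]
    exact mul_le_mul_of_nonneg_left add_sq_le (by positivity)
  · rw [tsum_mul_left, Summable.tsum_add ha hb]
    rfl

/-- Every holomorphic `f` on `𝔻` with real Taylor coefficients in `ℓ²_{3/4}` is uniquely
`f(z) = u(z²)√(1+z) + v(z²)√(1-z)` with `u, v` holomorphic with real `ℓ²_{3/4}` coefficients,
and `‖f‖ ≍ ‖u‖ + ‖v‖` with absolute constants. -/
theorem stmt12 :
    ∃ C₁ C₂ : ℝ, 0 < C₁ ∧ 0 < C₂ ∧
      ∀ a : ℕ → ℝ, MemL2r (3 / 4) a →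
        (∃! uv : (ℕ → ℝ) × (ℕ → ℝ), Rep12 a uv.1 uv.2) ∧
        ∀ u v : ℕ → ℝ, Rep12 a u v →
          C₁ * (normL2r (3 / 4) u + normL2r (3 / 4) v) ≤ normL2r (3 / 4) a ∧
          normL2r (3 / 4) a ≤ C₂ * (normL2r (3 / 4) u + normL2r (3 / 4) v) := by
  have hr : (1 / 2 : ℝ) < 3 / 4 := by norm_num
  have hr1 : (3 / 4 : ℝ) ≤ 1 := by norm_num
  set Z : ℝ := ∑' n : ℕ, ((1 + (n : ℝ)) ^ (2 * (3 / 4 : ℝ)))⁻¹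
  have hZ : 0 ≤ Z := tsum_nonneg fun n => by positivity
  set K : ℝ := 4 * Z * sqNorm (3 / 4) sqrtCoeff + 1
  have hK : 0 < K := by
    have := mul_nonneg hZ (sqNorm_nonneg (3 / 4) sqrtCoeff)
    simp only [K]
    linarith
  have mulS : ∀ c : ℕ → ℝ, MemL2r (3 / 4) c → MemL2r (3 / 4) (cauchyProd c sqrtCoeff) ∧
      sqNorm (3 / 4) (cauchyProd c sqrtCoeff) ≤ K * sqNorm (3 / 4) c := by
    intro c hc
    obtain ⟨h1, h2⟩ := hc.cauchyProd hr hr1 memL2r_sqrtCoeff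
    refine ⟨h1, h2.trans (mul_le_mul_of_nonneg_right ?_ (sqNorm_nonneg _ _))⟩
    exact le_add_of_nonneg_right zero_le_one
  have mulS' : ∀ c : ℕ → ℝ, MemL2r (3 / 4) c → MemL2r (3 / 4) (cauchyProd c sqrtCoeffNeg) ∧
      sqNorm (3 / 4) (cauchyProd c sqrtCoeffNeg) ≤ K * sqNorm (3 / 4) c := by
    intro c hc
    obtain ⟨h1, h2⟩ := hc.cauchyProd hr hr1 memL2r_sqrtCoeffNeg
    rw [sqNorm_sqrtCoeffNeg] at h2
    refine ⟨h1, h2.trans (mul_le_mul_of_nonneg_right ?_ (sqNorm_nonneg _ _))⟩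
    exact le_add_of_nonneg_right zero_le_one
  refine ⟨(2 * √K)⁻¹, √(8 * K), by positivity, by positivity, fun a ha => ?_⟩
  have hu := memL2r_oddPart (d := fun n => cauchyProd a sqrtCoeff (2 * n + 1))
    (by norm_num) (mulS a ha).1 (fun n => rfl)
  have hv := memL2r_oddPart (d := fun n => -cauchyProd a sqrtCoeffNeg (2 * n + 1))
    (by norm_num) (mulS' a ha).1 (fun n => neg_sq _)
  constructor
  · refine ⟨(fun n => cauchyProd a sqrtCoeff (2 * n + 1),
      fun n => -cauchyProd a sqrtCoeffNeg (2 * n + 1)), ?_, ?_⟩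
    · exact (rep12_iff ha).2 ⟨hu.1, hv.1, (eq_cauchyProd_add_iff _ _ _).2 ⟨rfl, rfl⟩⟩
    · rintro ⟨u, v⟩ h
      obtain ⟨h1, h2⟩ := (eq_cauchyProd_add_iff _ _ _).1 ((rep12_iff ha).1 h).2.2
      exact Prod.ext h1 h2
  · intro u v h
    obtain ⟨mu, mv, h⟩ := (rep12_iff ha).1 h
    simp only [normL2r_eq_sqrt]
    constructor
    · obtain ⟨h1, h2⟩ := (eq_cauchyProd_add_iff _ _ _).1 h
      have lu : √(sqNorm (3 / 4) u) ≤ √K * √(sqNorm (3 / 4) a) := by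
        rw [← Real.sqrt_mul hK.le, h1]
        exact Real.sqrt_le_sqrt (hu.2.trans (mulS a ha).2)
      have lv : √(sqNorm (3 / 4) v) ≤ √K * √(sqNorm (3 / 4) a) := by
        rw [← Real.sqrt_mul hK.le, h2]
        exact Real.sqrt_le_sqrt (hv.2.trans (mulS' a ha).2)
      rw [inv_mul_le_iff₀ (by positivity)]
      linarith
    · obtain ⟨eu, lu⟩ := memL2r_evenExt mu
      obtain ⟨ev, lv⟩ := memL2r_evenExt mv
      have hle : sqNorm (3 / 4) a ≤ 8 * K * (sqNorm (3 / 4) u + sqNorm (3 / 4) v) := by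
        rw [h]
        refine (sqNorm_add_le (mulS _ eu).1 (mulS' _ ev).1).trans ?_
        have h1 := (mulS _ eu).2.trans (mul_le_mul_of_nonneg_left lu hK.le)
        have h2 := (mulS' _ ev).2.trans (mul_le_mul_of_nonneg_left lv hK.le)
        linarith
      refine (Real.sqrt_le_sqrt hle).trans ?_
      rw [Real.sqrt_mul (by positivity)]
      refine mul_le_mul_of_nonneg_left ?_ (Real.sqrt_nonneg _)
      refine Real.sqrt_le_iff.2 ⟨by positivity, ?_⟩
      rw [add_sq, Real.sq_sqrt (sqNorm_nonneg _ _), Real.sq_sqrt (sqNorm_nonneg _ _)]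
      have : 0 ≤ √(sqNorm (3 / 4) u) * √(sqNorm (3 / 4) v) := by positivity
      linarith
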